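/- arXiv:2404.05263 — 6 statements merged into one kernel-verified Lean document; each statement's English description precedes it below -/
import Mathlib

section
/- For every m ∈ ℕ, every sequence s : ℕ → ℝ, and every n ∈ ℕ, one has D_{-m,n+m+1}(s) = (-1)^{binom(m+1,2)} · D_{m,n}(Es), i.e. det(a_{i+j-m,0}(s))_{i,j=0}^{n+m} = (-1)^{binom(m+1,2)} · det(a_{i+j+m,0}(Es))_{i,j=0}^{n-1}, where Es = (s_{k+1})_{k≥0} is the shifted sequence. -/
/-- The Catalan-like array `a_{n,k}(s)` for natural indices. -/
def catA (s : ℕ → ℝ) : ℕ → ℕ → ℝ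
  | 0, k => if k = 0 then 1 else 0
  | n + 1, k => (if k = 0 then 0 else catA s n (k - 1)) + s k * catA s n k + catA s n (k + 1)

/-- The array extended to integer indices, vanishing for `n < 0` or `k < 0`. -/
def catAZ (s : ℕ → ℝ) (n k : ℤ) : ℝ :=
  if 0 ≤ n ∧ 0 ≤ k then catA s n.toNat k.toNat else 0

/-- Hankel determinant `D_{m,k,n}(s) = det (a_{i+j+m,k}(s))_{i,j=0}^{n-1}`. -/
def hankelD (s : ℕ → ℝ) (m : ℤ) (k n : ℕ) : ℝ :=
  Matrix.det (Matrix.of fun i j : Fin n => catAZ s ((i : ℤ) + (j : ℤ) + m) (k : ℤ))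

open Finset Matrix

/-- Decomposition of the paths ending at height `k + 1` at their last visit to height `0`. -/
lemma catA_succ_succ (s : ℕ → ℝ) (n k : ℕ) :
    catA s (n + 1) (k + 1) =
      ∑ i ∈ range (n + 1), catA s i 0 * catA (fun k => s (k + 1)) (n - i) k := by
  induction n generalizing k with
  | zero => simp [catA]
  | succ n ih =>
    have key : ∀ i ∈ range (n + 1), catA s i 0 * catA (fun k => s (k + 1)) (n + 1 - i) k =
        (if k = 0 then 0 else catA s i 0 * catA (fun k => s (k + 1)) (n - i) (k - 1)) +
        s (k + 1) * (catA s i 0 * catA (fun k => s (k + 1)) (n - i) k) +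
        catA s i 0 * catA (fun k => s (k + 1)) (n - i) (k + 1) := by
      intro i hi
      rw [show n + 1 - i = (n - i) + 1 by grind, catA]
      split_ifs <;> ring
    rw [sum_range_succ, sum_congr rfl key, sum_add_distrib, sum_add_distrib, ← mul_sum,
      ← ih, ← ih, catA]
    rcases k with _ | k
    · simp [catA.eq_1]
      ring
    · simp [catA.eq_1, ih k]

/-- Coefficients of `1 - s₀ z - z² B(z)`, the reciprocal of the generating function of
`a_{n,0}(s)`, where `B` is the generating function of `a_{n,0}(Es)`. -/
def catInv (s : ℕ → ℝ) : ℕ → ℝ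
  | 0 => 1
  | 1 => -s 0
  | n + 2 => -catA (fun k => s (k + 1)) n 0

lemma sum_catA_mul_catInv (s : ℕ → ℝ) (d : ℕ) :
    ∑ l ∈ range (d + 1), catA s l 0 * catInv s (d - l) = if d = 0 then 1 else 0 := by
  rcases d with _ | _ | d
  · simp [catA, catInv]
  · simp [sum_range_succ, catA, catInv]
  · have key : ∀ l ∈ range (d + 1), catA s l 0 * catInv s (d + 2 - l) =
        -(catA s l 0 * catA (fun k => s (k + 1)) (d - l) 0) := by
      intro l hl
      rw [show d + 2 - l = (d - l) + 2 by grind, catInv]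
      ring
    rw [sum_range_succ, sum_range_succ, sum_congr rfl key, sum_neg_distrib, ← catA_succ_succ,
      catA.eq_2 s 0 (d + 1)]
    simp [catInv]
    ring

lemma det_antidiagonal (m : ℕ) :
    (Matrix.of fun i j : Fin m => if (i : ℕ) + j + 1 = m then (1 : ℝ) else 0).det =
      (-1) ^ m.choose 2 := by
  induction m with
  | zero => simp
  | succ m ih =>
    rw [det_succ_row_zero, sum_eq_single (Fin.last m)]
    · have : (Matrix.of fun i j : Fin (m + 1) =>
          if (i : ℕ) + j + 1 = m + 1 then (1 : ℝ) else 0).submatrix Fin.succ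
            (Fin.last m).succAbove =
          Matrix.of fun i j : Fin m => if (i : ℕ) + j + 1 = m then (1 : ℝ) else 0 := by
        ext i j
        simp [add_right_comm]
      rw [this, ih, Nat.choose_succ_succ' m 1, pow_add]
      simp
    · intro j _ hj
      have : (j : ℕ) ≠ m := fun h => hj (Fin.ext h)
      simp [this]
    · simp

lemma sum_catInv_mul_shift_of_le (s : ℕ → ℝ) {m j : ℕ} (hj : j ≤ m) (i : ℕ) :
    ∑ k ∈ range (i + 1), catInv s (i - k) * (if m ≤ k + j then catA s (k + j - m) 0 else 0) =
      if i + j = m then 1 else 0 := by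
  obtain ⟨r, rfl⟩ := Nat.exists_eq_add_of_le hj
  by_cases hi : i < r
  · rw [if_neg (by omega)]
    refine sum_eq_zero fun k hk => ?_
    rw [if_neg (by grind), mul_zero]
  · obtain ⟨d, rfl⟩ := Nat.exists_eq_add_of_le (not_lt.mp hi)
    rw [add_assoc, sum_range_add, sum_eq_zero, zero_add]
    · simp only [show r + d + j = j + r ↔ d = 0 by omega]
      rw [← sum_catA_mul_catInv s d]
      refine sum_congr rfl fun l _ => ?_
      rw [if_pos (by omega), show r + l + j - (j + r) = l by omega,
        show r + d - (r + l) = d - l by omega, mul_comm]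
    · intro k hk
      rw [if_neg (by grind), mul_zero]

lemma sum_catInv_mul_shift_of_gt (s : ℕ → ℝ) (m p q : ℕ) :
    ∑ k ∈ range (m + 1 + p + 1), catInv s (m + 1 + p - k) * catA s (k + q + 1) 0 =
      ∑ r ∈ range (q + 1), catA (fun k => s (k + 1)) (m + p + r) 0 * catA s (q - r) 0 := by
  have h := sum_catA_mul_catInv s (q + 1 + (m + 1 + p))
  rw [add_assoc, sum_range_add, if_neg (by omega)] at h
  have h₁ : ∑ k ∈ range (m + 1 + p + 1), catInv s (m + 1 + p - k) * catA s (k + q + 1) 0 =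
      ∑ k ∈ range (m + 1 + p + 1),
        catA s (q + 1 + k) 0 * catInv s (q + 1 + (m + 1 + p) - (q + 1 + k)) := by
    refine sum_congr rfl fun k _ => ?_
    rw [Nat.add_sub_add_left, mul_comm, show k + q + 1 = q + 1 + k by omega]
  have h₂ : ∑ r ∈ range (q + 1), catA (fun k => s (k + 1)) (m + p + r) 0 * catA s (q - r) 0 =
      -∑ l ∈ range (q + 1), catA s l 0 * catInv s (q + 1 + (m + 1 + p) - l) := by
    rw [← sum_range_reflect, ← sum_neg_distrib]
    refine sum_congr rfl fun l hl => ?_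
    rw [show q + 1 + (m + 1 + p) - l = (m + p + (q + 1 - 1 - l)) + 2 by grind, catInv,
      show q - (q + 1 - 1 - l) = l by grind]
    ring
  rw [h₁, h₂]
  linarith

lemma catAZ_sub_zero (s : ℕ → ℝ) (i j m : ℕ) :
    catAZ s ((i : ℤ) + j + -m) 0 = if m ≤ i + j then catA s (i + j - m) 0 else 0 := by
  unfold catAZ
  by_cases h : m ≤ i + j
  · rw [if_pos h, if_pos (by omega)]
    congr 1
    omega
  · rw [if_neg h, if_neg (by omega)]

lemma sum_fin_ite_le {N i : ℕ} (hi : i < N) (f g : ℕ → ℝ) :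
    ∑ k : Fin N, (if (k : ℕ) ≤ i then f k else 0) * g k =
      ∑ k ∈ range (i + 1), f k * g k := by
  rw [Fin.sum_univ_eq_sum_range (fun k => (if k ≤ i then f k else 0) * g k),
    ← sum_subset (range_mono (Nat.succ_le_of_lt hi))]
  · exact sum_congr rfl fun k hk => by rw [if_pos (by grind)]
  · intro k _ hk
    rw [if_neg (by grind), zero_mul]

/-- Theorem 1, main identity: `D_{-m,n+m+1}(s) = (-1)^{C(m+1,2)} D_{m,n}(Es)`
where `Es` is the shifted sequence. -/
theorem backward_hankel_eq (m : ℕ) (s : ℕ → ℝ) (n : ℕ) :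
    hankelD s (-(m : ℤ)) 0 (n + m + 1) =
      (-1 : ℝ) ^ Nat.choose (m + 1) 2 * hankelD (fun k => s (k + 1)) (m : ℤ) 0 n := by
  rw [show n + m + 1 = m + 1 + n by omega]
  unfold hankelD
  set H := Matrix.of fun i j : Fin (m + 1 + n) => catAZ s ((i : ℤ) + j + -m) (0 : ℕ)
  set B := Matrix.of fun i j : Fin n =>
    catAZ (fun k => s (k + 1)) ((i : ℤ) + j + m) (0 : ℕ)
  let U : Matrix (Fin (m + 1 + n)) (Fin (m + 1 + n)) ℝ :=
    .of fun i k => if (k : ℕ) ≤ i then catInv s (i - k) else 0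
  let T : Matrix (Fin n) (Fin n) ℝ := .of fun r q => if (r : ℕ) ≤ q then catA s (q - r) 0 else 0
  have hU : U.det = 1 := by
    rw [det_of_isLowerTriangular]
    · simp [U, catInv]
    · intro i j hij
      have : i < j := hij
      simp [U, this]
  have hT : T.det = 1 := by
    rw [det_of_isUpperTriangular]
    · simp [T, catA]
    · intro i j hij
      have : j < i := hij
      simp [T, this]
  have hUH (i j : Fin (m + 1 + n)) : (U * H) i j = ∑ k ∈ range (i + 1),
      catInv s (i - k) * (if m ≤ k + j then catA s (k + j - m) 0 else 0) := by
    rw [← sum_fin_ite_le i.isLt]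
    simp [mul_apply, U, H, catAZ_sub_zero]
  have hblocks : (U * H).submatrix finSumFinEquiv finSumFinEquiv =
      fromBlocks
        (.of fun i j : Fin (m + 1) => if (i : ℕ) + j + 1 = m + 1 then (1 : ℝ) else 0)
        (.of fun i j => (U * H) (Fin.castAdd n i) (Fin.natAdd (m + 1) j)) 0 (B * T) := by
    ext (i | i) (j | j)
    · simp [hUH, sum_catInv_mul_shift_of_le s (Nat.lt_succ_iff.mp j.isLt), -mul_ite]
    · simp
    · have : m + 1 + (i : ℕ) + j ≠ m := by omega
      simp [hUH, sum_catInv_mul_shift_of_le s (Nat.lt_succ_iff.mp j.isLt), this, -mul_ite]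
    · have hk (k : ℕ) : (if m ≤ k + (m + 1 + (j : ℕ)) then
          catA s (k + (m + 1 + j) - m) 0 else 0) = catA s (k + j + 1) 0 := by
        rw [if_pos (by omega), show k + (m + 1 + (j : ℕ)) - m = k + j + 1 by omega]
      have hBT : (B * T) i j = ∑ k : Fin n, (if (k : ℕ) ≤ j then catA s (j - k) 0 else 0) *
          catA (fun k => s (k + 1)) (m + i + k) 0 := by
        rw [mul_apply]
        refine sum_congr rfl fun k _ => ?_
        have : B i k = catA (fun k => s (k + 1)) (m + i + k) 0 := by
          simp only [B, of_apply, catAZ]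
          rw [if_pos (by omega)]
          congr 1
          omega
        rw [this, mul_comm]
        rfl
      rw [fromBlocks_apply₂₂, hBT, sum_fin_ite_le j.isLt (fun k => catA s (j - k) 0)
        (fun k => catA (fun k => s (k + 1)) (m + i + k) 0)]
      simp only [submatrix_apply, finSumFinEquiv_apply_right, hUH, Fin.val_natAdd, hk,
        sum_catInv_mul_shift_of_gt]
      exact sum_congr rfl fun k _ => mul_comm _ _
  calc H.det = (U * H).det := by rw [det_mul, hU, one_mul]
    _ = ((U * H).submatrix finSumFinEquiv finSumFinEquiv).det :=
      (det_submatrix_equiv_self _ _).symm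
    _ = _ := by rw [hblocks, det_fromBlocks_zero₂₁, det_antidiagonal, det_mul, hT, mul_one]
end

section
/- For every c ∈ ℝ, all k, m ∈ ℕ, and every integer n with 0 < n ≤ m + k, the backwards-shifted Hankel determinant of the constant-weight Catalan-like array vanishes: D_{-m,k,n}(c) = det(a_{i+j-m,k}(c))_{i,j=0}^{n-1} = 0. -/
theorem catA_eq_zero_of_lt (s : ℕ → ℝ) {n k : ℕ} (h : n < k) : catA s n k = 0 := by
  induction n generalizing k with
  | zero => simp [catA, h.ne']
  | succ n ih =>
    rw [catA, ih (by omega : n < k - 1), ih (by omega : n < k), ih (by omega : n < k + 1)]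
    simp

theorem catAZ_eq_zero_of_lt (s : ℕ → ℝ) {n k : ℤ} (h : n < k) : catAZ s n k = 0 := by
  unfold catAZ
  split_ifs
  · exact catA_eq_zero_of_lt s (by omega)
  · rfl

/-- Theorem 2, first part: for the constant sequence `c` and `0 < n ≤ m + k`,
the backwards-shifted Hankel determinant vanishes: `D_{-m,k,n}(c) = 0`. -/
theorem backward_hankel_const_vanishes (c : ℝ) (k m : ℕ) (n : ℕ)
    (hn : 0 < n) (hnmk : n ≤ m + k) :
    hankelD (fun _ => c) (-(m : ℤ)) k n = 0 := by
  refine Matrix.det_eq_zero_of_row_eq_zero ⟨0, hn⟩ fun j => ?_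
  exact catAZ_eq_zero_of_lt _ (by have := j.isLt; push_cast; omega)
end

section
/- For every c ∈ ℝ and all k, n ∈ ℕ, the unshifted Hankel determinant at height k of size (k+1)n satisfies D_{0,k,(k+1)n}(c) = ((-1)^{binom(k+1,2)})^n. -/
open Polynomial

namespace Fin

/-- The order-reversing permutation of `Fin n` has sign `(-1) ^ (n choose 2)`. -/
theorem sign_revPerm (n : ℕ) :
    Equiv.Perm.sign (Fin.revPerm : Equiv.Perm (Fin n)) = (-1) ^ n.choose 2 := by
  induction n with
  | zero => simp [Subsingleton.elim (Fin.revPerm : Equiv.Perm (Fin 0)) 1]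
  | succ n ih =>
    have h : finRotate (n + 1) * Fin.revPerm =
        Equiv.Perm.decomposeFin.symm (0, (Fin.revPerm : Equiv.Perm (Fin n))) := by
      ext i
      induction i using Fin.cases with
      | zero => simp [Equiv.Perm.decomposeFin_symm_apply_zero]
      | succ i =>
        rw [Equiv.Perm.decomposeFin_symm_apply_succ]
        simp only [Equiv.Perm.mul_apply, Fin.revPerm_apply, Equiv.swap_self, Equiv.refl_apply,
          Fin.val_succ, Fin.rev_succ]
        rw [finRotate_apply, Fin.coeSucc_eq_succ, Fin.val_succ]
    have h' := congrArg Equiv.Perm.sign h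
    rw [Equiv.Perm.sign_mul, sign_finRotate, Equiv.Perm.decomposeFin.symm_sign, ih] at h'
    have hsq : ((-1 : ℤˣ) ^ n) * (-1) ^ n = 1 := by rw [← mul_pow]; simp
    rw [Nat.choose_succ_succ' n 1, Nat.choose_one_right, pow_add]
    calc Equiv.Perm.sign (Fin.revPerm : Equiv.Perm (Fin (n + 1)))
        = (-1) ^ n * ((-1) ^ n * Equiv.Perm.sign (Fin.revPerm : Equiv.Perm (Fin (n + 1)))) := by
          rw [← mul_assoc, hsq, one_mul]
      _ = _ := by simpa using h'

end Fin

namespace Polynomial.Chebyshev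

theorem isMonicOfDegree_S (n : ℕ) : IsMonicOfDegree (S ℝ n) n := by
  induction n using Nat.twoStepInduction with
  | zero => simp
  | one => simpa using isMonicOfDegree_X ℝ
  | more n ih₁ ih₂ =>
    have h := ((isMonicOfDegree_X ℝ).mul ih₂).sub (q := S ℝ n) (by rw [ih₁.natDegree_eq]; omega)
    push_cast at h ⊢
    rw [S_add_two]
    rwa [show 1 + (n + 1) = n + 2 by omega] at h

theorem isMonicOfDegree_C (n : ℕ) : IsMonicOfDegree (C ℝ (n + 1 : ℕ)) (n + 1) := by
  induction n using Nat.twoStepInduction with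
  | zero => simpa using isMonicOfDegree_X ℝ
  | one =>
    simpa [C_two] using (isMonicOfDegree_X_pow ℝ 2).sub (q := 2) (by simp)
  | more n ih₁ ih₂ =>
    have h := ((isMonicOfDegree_X ℝ).mul ih₂).sub (q := C ℝ (n + 1 : ℕ))
      (by rw [ih₁.natDegree_eq]; omega)
    have e : ((n + 2 + 1 : ℕ) : ℤ) = (n + 1 : ℕ) + 2 := by push_cast; ring
    rw [e, C_add_two]
    rw [show 1 + (n + 1 + 1) = n + 2 + 1 by omega] at h
    exact_mod_cast h

theorem S_mul_C (m r : ℤ) : S ℝ m * C ℝ r = S ℝ (m + r) + S ℝ (m - r) := by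
  induction r using Polynomial.Chebyshev.induct with
  | zero => simp; ring
  | one => rw [C_one, S_add_one]; ring
  | add_two r ih₁ ih₂ =>
    have h₁ := S_add_two ℝ (m + r)
    have h₂ := S_sub_two ℝ (m - r)
    have h₃ := C_add_two ℝ r
    linear_combination (norm := ring_nf) S ℝ m * h₃ - h₁ - h₂ + X * ih₁ - ih₂
  | neg_add_one r ih₁ ih₂ =>
    have h₁ := S_sub_one ℝ (m - r)
    have h₂ := S_add_one ℝ (m + r)
    have h₃ := C_sub_one ℝ (-r)
    linear_combination (norm := ring_nf) S ℝ m * h₃ - h₁ - h₂ + X * ih₁ - ih₂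

theorem S_mul_S_comp_C (k q : ℕ) :
    S ℝ k * (S ℝ q).comp (C ℝ (k + 1 : ℕ)) = S ℝ ((q + 1) * (k + 1) - 1) := by
  induction q using Nat.twoStepInduction with
  | zero => simp
  | one =>
    have h := S_mul_C k (k + 1)
    simp only [sub_add_cancel_left, S_neg_one, add_zero] at h
    simp only [Nat.cast_one, S_one, X_comp, Nat.cast_add]
    rw [h]
    ring_nf
  | more q ih₁ ih₂ =>
    have h := S_mul_C ((q + 2) * (k + 1) - 1) (k + 1)
    push_cast at *
    rw [S_add_two, sub_comp, mul_comp, X_comp]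
    linear_combination (norm := ring_nf) C ℝ (k + 1) * ih₂ - ih₁ + h

end Polynomial.Chebyshev

open Polynomial.Chebyshev (S)

/-- The Gram determinant of a bilinear form on polynomials does not depend on the choice of a
monic basis on either side. -/
theorem det_bilin_of_isMonicOfDegree (B : ℝ[X] →ₗ[ℝ] ℝ[X] →ₗ[ℝ] ℝ) {n : ℕ} {p q : ℕ → ℝ[X]}
    (hp : ∀ i, IsMonicOfDegree (p i) i) (hq : ∀ i, IsMonicOfDegree (q i) i) :
    (Matrix.of fun i j : Fin n => B (p i) (q j)).det =
      (Matrix.of fun i j : Fin n => B (X ^ (i : ℕ)) (X ^ (j : ℕ))).det := by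
  have expand : ∀ {f : ℕ → ℝ[X]}, (∀ i, IsMonicOfDegree (f i) i) → ∀ j : Fin n,
      f j = ∑ a : Fin n, (f j).coeff a • (X : ℝ[X]) ^ (a : ℕ) := by
    intro f hf j
    have hdeg : (f j).natDegree < n := by rw [(hf j).natDegree_eq]; exact j.2
    conv_lhs => rw [as_sum_range_C_mul_X_pow' (f j) hdeg]
    rw [← Fin.sum_univ_eq_sum_range (fun a => Polynomial.C ((f j).coeff a) * X ^ a)]
    simp [smul_eq_C_mul]
  have det_one : ∀ {f : ℕ → ℝ[X]}, (∀ i, IsMonicOfDegree (f i) i) →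
      (Matrix.of fun a j : Fin n => (f j).coeff a).det = 1 := fun hf =>
    Matrix.det_matrixOfPolynomials _ (fun i => (hf i).natDegree_eq) fun i => (hf i).monic
  have h : (Matrix.of fun i j : Fin n => B (p i) (q j)) =
      (Matrix.of fun a j : Fin n => (p j).coeff a).transpose *
        (Matrix.of fun i j : Fin n => B (X ^ (i : ℕ)) (X ^ (j : ℕ))) *
          (Matrix.of fun a j : Fin n => (q j).coeff a) := by
    ext i j
    conv_lhs => rw [Matrix.of_apply, expand hp i, expand hq j]
    simp only [map_sum, map_smul, LinearMap.sum_apply, LinearMap.smul_apply, Matrix.mul_apply,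
      Matrix.transpose_apply, Matrix.of_apply, smul_eq_mul]
    exact Finset.sum_congr rfl fun b _ => mul_comm _ _
  rw [h, Matrix.det_mul, Matrix.det_mul, Matrix.det_transpose, det_one hp, det_one hq]
  ring

/-- The adjacency operator of the one-sided infinite path. -/
def pathOp : Module.End ℝ (ℕ → ℝ) where
  toFun v k := (if k = 0 then 0 else v (k - 1)) + v (k + 1)
  map_add' v w := by ext k; dsimp; split_ifs <;> ring
  map_smul' c v := by ext k; dsimp; split_ifs <;> ring

theorem pathOp_apply (v : ℕ → ℝ) (k : ℕ) :
    pathOp v k = (if k = 0 then 0 else v (k - 1)) + v (k + 1) := rfl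

/-- The moment functional `p ↦ ⟨p(J) e₀, e₀⟩` of the adjacency operator `J` of the path. -/
noncomputable def pathMoment : ℝ[X] →ₗ[ℝ] ℝ :=
  LinearMap.proj 0 ∘ₗ LinearMap.applyₗ (Pi.single 0 1) ∘ₗ (aeval pathOp).toLinearMap

theorem pathMoment_apply (p : ℝ[X]) :
    pathMoment p = aeval pathOp p (Pi.single 0 1) 0 := rfl

theorem aeval_pathOp_S_apply_zero (k : ℕ) (v : ℕ → ℝ) :
    aeval pathOp (S ℝ k) v 0 = v k := by
  induction k using Nat.twoStepInduction generalizing v with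
  | zero => simp
  | one => simp [pathOp_apply]
  | more k ih₁ ih₂ =>
    push_cast at ih₂ ⊢
    rw [Polynomial.Chebyshev.S_add_two, mul_comm, map_sub, map_mul, aeval_X, LinearMap.sub_apply,
      Module.End.mul_apply, Pi.sub_apply, ih₁, ih₂, pathOp_apply]
    simp

theorem aeval_pathOp_S_single (k : ℕ) :
    aeval pathOp (S ℝ k) (Pi.single 0 1) = Pi.single k 1 := by
  induction k using Nat.twoStepInduction with
  | zero => simp
  | one =>
    ext j
    rcases j with _ | _ | j <;> simp [pathOp_apply]
  | more k ih₁ ih₂ =>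
    push_cast at ih₂ ⊢
    rw [Polynomial.Chebyshev.S_add_two, map_sub, map_mul, aeval_X, LinearMap.sub_apply,
      Module.End.mul_apply, ih₁, ih₂]
    ext j
    rcases j with _ | j
    · simp [pathOp_apply, Pi.single_apply, eq_comm]
    · simp only [pathOp_apply, Pi.single_apply, Pi.sub_apply]
      grind

theorem pathMoment_mul_S (p : ℝ[X]) (k : ℕ) :
    pathMoment (p * S ℝ k) = aeval pathOp p (Pi.single 0 1) k := by
  rw [pathMoment_apply, mul_comm, map_mul, Module.End.mul_apply, aeval_pathOp_S_apply_zero]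

theorem pathMoment_S_mul_S (i k : ℕ) :
    pathMoment (S ℝ i * S ℝ k) = if k = i then 1 else 0 := by
  rw [pathMoment_mul_S, aeval_pathOp_S_single, Pi.single_apply]

theorem catA_const_eq_pathMoment (c : ℝ) (n k : ℕ) :
    catA (fun _ => c) n k = pathMoment ((X + C c) ^ n * S ℝ k) := by
  rw [pathMoment_mul_S]
  induction n generalizing k with
  | zero => simp [catA, Pi.single_apply]
  | succ n ih =>
    rw [catA, pow_succ', map_mul, Module.End.mul_apply]
    simp only [ih, map_add, aeval_X, aeval_C, LinearMap.add_apply, Pi.add_apply, pathOp_apply,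
      Module.algebraMap_end_apply, Pi.smul_apply, smul_eq_mul]
    ring

/-- A monic polynomial of degree `j` whose product with `S k` is a sum of at most two of the
polynomials `S i`. -/
noncomputable def splitBasis (k j : ℕ) : ℝ[X] :=
  (S ℝ (j / (k + 1) : ℕ)).comp (Chebyshev.C ℝ (k + 1 : ℕ)) *
    if j % (k + 1) = 0 then 1 else Chebyshev.C ℝ (j % (k + 1) : ℕ)

theorem isMonicOfDegree_splitBasis (k j : ℕ) : IsMonicOfDegree (splitBasis k j) j := by
  have h₁ := (Chebyshev.isMonicOfDegree_S (j / (k + 1))).comp (Nat.succ_ne_zero k)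
    (Chebyshev.isMonicOfDegree_C k)
  have h₂ : IsMonicOfDegree (if j % (k + 1) = 0 then 1 else Chebyshev.C ℝ (j % (k + 1) : ℕ))
      (j % (k + 1)) := by
    split_ifs with h
    · simp [h]
    · obtain ⟨r, hr⟩ := Nat.exists_eq_succ_of_ne_zero h
      rw [hr]
      exact Chebyshev.isMonicOfDegree_C r
  have h := h₁.mul h₂
  rwa [Nat.div_add_mod'] at h

theorem splitBasis_mul_S (k q r : ℕ) (hr : r ≤ k) :
    splitBasis k (q * (k + 1) + (k - r)) * S ℝ k =
      S ℝ (q * (k + 1) + r : ℕ) + if r = k then 0 else S ℝ (q * (k + 1) + (2 * k - r) : ℕ) := by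
  have hdiv : (q * (k + 1) + (k - r)) / (k + 1) = q := by
    rw [mul_comm, Nat.mul_add_div (by omega), Nat.div_eq_of_lt (by omega), add_zero]
  have hmod : (q * (k + 1) + (k - r)) % (k + 1) = k - r := by
    rw [Nat.mul_add_mod', Nat.mod_eq_of_lt (by omega)]
  have h := Chebyshev.S_mul_S_comp_C k q
  rw [splitBasis, hdiv, hmod, mul_right_comm, mul_comm _ (S ℝ k), h]
  split_ifs with h₁ h₂ h₂
  · obtain rfl : r = k := h₂
    rw [mul_one, add_zero]
    congr 1
    push_cast
    ring
  · omega
  · omega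
  · rw [Chebyshev.S_mul_C, add_comm]
    congr 2
    · push_cast [hr]
      ring
    · push_cast [hr, (by omega : r ≤ 2 * k)]
      ring

/-- Reversal inside each block of `k + 1` consecutive indices. -/
def blockRev (n k : ℕ) : Equiv.Perm (Fin (n * (k + 1))) :=
  finProdFinEquiv.permCongr (Equiv.prodCongrRight fun _ => Fin.revPerm)

theorem sign_blockRev (n k : ℕ) :
    Equiv.Perm.sign (blockRev n k) = ((-1) ^ (k + 1).choose 2) ^ n := by
  simp [blockRev, Equiv.Perm.sign_permCongr, Equiv.Perm.sign_prodCongrRight, Fin.sign_revPerm]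

theorem blockRev_val (n k : ℕ) (j : Fin (n * (k + 1))) :
    (blockRev n k j : ℕ) = (j : ℕ) / (k + 1) * (k + 1) + (k - (j : ℕ) % (k + 1)) := by
  simp [blockRev, Equiv.permCongr_apply, Fin.val_rev, Fin.modNat, Fin.divNat, mul_comm, add_comm]
  omega

theorem pathMoment_S_mul_splitBasis (n k : ℕ) (i j : Fin (n * (k + 1))) :
    pathMoment (S ℝ (i : ℕ) * (splitBasis k (blockRev n k j) * S ℝ k)) =
      (if (j : ℕ) = i then 1 else 0) +
        if (j : ℕ) % (k + 1) = k then 0 else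
          if (j : ℕ) / (k + 1) * (k + 1) + (2 * k - (j : ℕ) % (k + 1)) = i then 1 else 0 := by
  have hmod : (j : ℕ) % (k + 1) ≤ k := Nat.lt_succ_iff.mp (Nat.mod_lt _ k.succ_pos)
  rw [blockRev_val, splitBasis_mul_S _ _ _ hmod, Nat.div_add_mod', mul_add, map_add,
    pathMoment_S_mul_S]
  congr 1
  split_ifs with h₁ h₂
  · simp
  · rw [pathMoment_S_mul_S, if_pos h₂]
  · rw [pathMoment_S_mul_S, if_neg h₂]

theorem det_pathMoment_S_mul_splitBasis (n k : ℕ) :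
    (Matrix.of fun i j : Fin (n * (k + 1)) =>
      pathMoment (S ℝ (i : ℕ) * (splitBasis k j * S ℝ k))).det =
      ((-1) ^ (k + 1).choose 2) ^ n := by
  set M := Matrix.of fun i j : Fin (n * (k + 1)) =>
      pathMoment (S ℝ (i : ℕ) * (splitBasis k j * S ℝ k))
  have hentry : ∀ i j, M.submatrix id (blockRev n k) i j = _ :=
    fun i j => pathMoment_S_mul_splitBasis n k i j
  have hdecomp : ∀ j : ℕ, j % (k + 1) ≠ k →
      j < j / (k + 1) * (k + 1) + (2 * k - j % (k + 1)) := by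
    intro j hj
    have h₁ := Nat.div_add_mod' j (k + 1)
    have h₂ : j % (k + 1) < k + 1 := Nat.mod_lt j k.succ_pos
    omega
  have hdet : (M.submatrix id (blockRev n k)).det = 1 := by
    rw [Matrix.det_of_isLowerTriangular]
    · refine Finset.prod_eq_one fun i _ => ?_
      rw [hentry]
      split_ifs with h₁ h₂ h₃
      · simp
      · exact absurd h₃ (hdecomp i h₂).ne'
      all_goals simp_all
    · intro i j hij
      have hij : (i : ℕ) < j := hij
      rw [hentry]
      have := hdecomp j
      split_ifs <;> first | omega | simp
  rw [Matrix.det_permute', sign_blockRev] at hdet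
  have hsq : (((-1 : ℝ) ^ (k + 1).choose 2) ^ n) * ((-1) ^ (k + 1).choose 2) ^ n = 1 := by
    rw [← mul_pow, ← mul_pow]; simp
  push_cast at hdet
  linear_combination ((-1) ^ (k + 1).choose 2) ^ n * hdet - M.det * hsq

/-- Corollary, first part: `D_{0,k,(k+1)n}(c) = ((-1)^{C(k+1,2)})^n`. -/
theorem hankel_const_periodic (c : ℝ) (k n : ℕ) :
    hankelD (fun _ => c) 0 k ((k + 1) * n) =
      ((-1 : ℝ) ^ Nat.choose (k + 1) 2) ^ n := by
  rw [mul_comm, ← det_pathMoment_S_mul_splitBasis, hankelD]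
  let B : ℝ[X] →ₗ[ℝ] ℝ[X] →ₗ[ℝ] ℝ :=
    (LinearMap.mul ℝ ℝ[X]).compr₂ (pathMoment ∘ₗ LinearMap.mulRight ℝ (S ℝ k))
  have hX : ∀ i, IsMonicOfDegree ((X + C c : ℝ[X]) ^ i) i := fun i => by
    simpa using (isMonicOfDegree_X_add_one c).pow i
  have hleft := det_bilin_of_isMonicOfDegree B (n := n * (k + 1)) hX hX
  have hright := det_bilin_of_isMonicOfDegree B (n := n * (k + 1))
    Chebyshev.isMonicOfDegree_S (isMonicOfDegree_splitBasis k)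
  convert hleft.trans hright.symm using 3
  · ext i j
    have h : 0 ≤ (i : ℤ) + j + 0 ∧ 0 ≤ (k : ℤ) := by omega
    have e : ((i : ℤ) + j + 0).toNat = i + j := by omega
    rw [catAZ, if_pos h, e, Int.toNat_natCast, catA_const_eq_pathMoment, pow_add]
    rfl
  · ext i j
    exact congrArg pathMoment (mul_assoc _ _ _).symm
end

section
/- For every c ∈ ℝ and every k ∈ ℕ, one has in ℝ⟦X⟧ the identity X^k · A(X,c)^{k+1} = Σ_{n≥0} a_{n,k}(c) X^n; equivalently, for every n ∈ ℕ the coefficient of X^n in X^k · A(X,c)^{k+1} equals a_{n,k}(c). -/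
open PowerSeries in
/-- The generating function `Σ_{n≥0} a_{n,k}(s) Xⁿ` of the `k`-th column. -/
noncomputable def colGenFun (s : ℕ → ℝ) (k : ℕ) : PowerSeries ℝ :=
  mk fun n => catA s n k

open PowerSeries in
theorem colGenFun_zero (s : ℕ → ℝ) :
    colGenFun s 0 = 1 + X * (C (s 0) * colGenFun s 0 + colGenFun s 1) := by
  ext n
  cases n with
  | zero => simp [colGenFun, catA]
  | succ n => simp [colGenFun, catA, coeff_succ_X_mul, coeff_one]

open PowerSeries in
theorem colGenFun_succ (s : ℕ → ℝ) (k : ℕ) :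
    colGenFun s (k + 1) =
      X * (colGenFun s k + C (s (k + 1)) * colGenFun s (k + 1) + colGenFun s (k + 2)) := by
  ext n
  cases n with
  | zero => simp [colGenFun, catA]
  | succ n => simp [colGenFun, catA, coeff_succ_X_mul]

open PowerSeries in
/-- A family of power series satisfying the homogeneous column recurrence vanishes. -/
theorem eq_zero_of_column_recurrence (c : ℝ) (E : ℕ → PowerSeries ℝ)
    (h0 : E 0 = X * (C c * E 0 + E 1))
    (hs : ∀ k, E (k + 1) = X * (E k + C c * E (k + 1) + E (k + 2))) (k : ℕ) : E k = 0 := by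
  ext n
  rw [map_zero]
  induction n generalizing k with
  | zero =>
    cases k with
    | zero => rw [h0, coeff_zero_X_mul]
    | succ k => rw [hs, coeff_zero_X_mul]
  | succ n ih =>
    cases k with
    | zero => rw [h0, coeff_succ_X_mul]; simp [ih]
    | succ k => rw [hs, coeff_succ_X_mul]; simp [ih]

open PowerSeries in
theorem colGenFun_const_succ (c : ℝ) (k : ℕ) :
    colGenFun (fun _ => c) (k + 1) =
      X * colGenFun (fun _ => c) 0 * colGenFun (fun _ => c) k := by
  set A := colGenFun fun _ => c
  have h0 : A 0 = 1 + X * (C c * A 0 + A 1) := colGenFun_zero _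
  have hs (k : ℕ) : A (k + 1) = X * (A k + C c * A (k + 1) + A (k + 2)) := colGenFun_succ _ k
  refine sub_eq_zero.mp
    (eq_zero_of_column_recurrence c (fun k => A (k + 1) - X * A 0 * A k) ?_ (fun k => ?_) k)
  · linear_combination hs 0 - X * A 0 * h0
  · linear_combination hs (k + 1) - X * A 0 * hs k

/-- Identity (16): `X^k A(X,c)^{k+1} = Σ_{n≥0} a_{n,k}(c) Xⁿ`. -/
theorem genFun_const_pow (c : ℝ) (k : ℕ) :
    PowerSeries.X ^ k * (PowerSeries.mk (fun n => catA (fun _ => c) n 0)) ^ (k + 1) =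
      PowerSeries.mk (fun n => catA (fun _ => c) n k) := by
  change PowerSeries.X ^ k * colGenFun (fun _ => c) 0 ^ (k + 1) = colGenFun (fun _ => c) k
  induction k with
  | zero => simp
  | succ k ih => rw [colGenFun_const_succ, ← ih]; ring
end

section
/- For every sequence s : ℕ → ℝ and every n ∈ ℕ, the unshifted Hankel determinant of the Catalan-like numbers equals 1: D_{0,n}(s) = det(a_{i+j,0}(s))_{i,j=0}^{n-1} = 1. -/
theorem catA_self (s : ℕ → ℝ) (n : ℕ) : catA s n n = 1 := by
  induction n with
  | zero => simp [catA]
  | succ n ih =>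
    simp [catA, ih, catA_eq_zero_of_lt s (show n < n + 1 by omega),
      catA_eq_zero_of_lt s (show n < n + 1 + 1 by omega)]

/-- Discrete Green formula for the tridiagonal recurrence defining `catA`. -/
theorem sum_catA_succ_mul_sub (s : ℕ → ℝ) (i j N : ℕ) :
    ∑ k ∈ Finset.range (N + 1), (catA s (i + 1) k * catA s j k - catA s i k * catA s (j + 1) k) =
      catA s i (N + 1) * catA s j N - catA s i N * catA s j (N + 1) := by
  induction N with
  | zero =>
    simp [catA]
    ring
  | succ N ih =>
    rw [Finset.sum_range_succ, ih]
    simp [catA]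
    ring

theorem sum_catA_mul_catA (s : ℕ → ℝ) {i N : ℕ} (j : ℕ) (h : i ≤ N) :
    ∑ k ∈ Finset.range (N + 1), catA s i k * catA s j k = catA s (i + j) 0 := by
  induction i generalizing j with
  | zero => simp [catA]
  | succ i ih =>
    have green := sum_catA_succ_mul_sub s i j N
    rw [catA_eq_zero_of_lt s (show i < N + 1 by omega), catA_eq_zero_of_lt s (show i < N by omega),
      Finset.sum_sub_distrib, ih (j + 1) (by omega)] at green
    rw [show i + 1 + j = i + (j + 1) by omega]
    linarith

/-- Identity (3), first part: `D_{0,n}(s) = 1` for every sequence `s`. -/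
theorem hankel_zero_shift (s : ℕ → ℝ) (n : ℕ) :
    hankelD s 0 0 n = 1 := by
  let L : Matrix (Fin n) (Fin n) ℝ := Matrix.of fun i k => catA s i k
  have hL : L.det = 1 := by
    rw [Matrix.det_of_isLowerTriangular L fun i k h => catA_eq_zero_of_lt s h]
    simp [L, catA_self]
  have factor : (Matrix.of fun i j : Fin n => catAZ s ((i : ℤ) + (j : ℤ) + 0) ((0 : ℕ) : ℤ)) =
      L * L.transpose := by
    ext i j
    obtain ⟨N, rfl⟩ : ∃ N, n = N + 1 := ⟨n - 1, by have := i.isLt; omega⟩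
    have hij : ((i : ℤ) + (j : ℤ)).toNat = (i : ℕ) + j := by omega
    have hnonneg : (0 : ℤ) ≤ (i : ℤ) + (j : ℤ) := by omega
    simp only [Matrix.mul_apply, Matrix.transpose_apply, Matrix.of_apply, L, catAZ, add_zero,
      Nat.cast_zero, le_refl, and_true, hnonneg, if_true, hij, Int.toNat_zero]
    rw [Fin.sum_univ_eq_sum_range (fun k => catA s i k * catA s j k),
      sum_catA_mul_catA s j (by omega)]
  rw [hankelD, factor, Matrix.det_mul, Matrix.det_transpose, hL, one_mul]
end

section
/- Let s : ℕ → ℝ be the sequence with s_0 = 1 and s_k = 0 for all k ≥ 1. Then for every n ∈ ℕ, the Catalan-like number a_{n,0}(s) equals the central binomial coefficient binom(n, ⌊n/2⌋). -/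
/-- Replacing the lower index `n / 2` of a central binomial coefficient by `(n + 1) / 2`. -/
theorem choose_half_succ (n : ℕ) : n.choose ((n + 1) / 2) = n.choose (n / 2) :=
  Nat.choose_symm_of_eq_add (by lia)

/-- Closed form of the whole array for `s = (1, 0, 0, …)`. It vanishes for `n < k`, since then
the lower index exceeds `n`. -/
theorem catA_eq_choose (s : ℕ → ℝ) (h0 : s 0 = 1) (h1 : ∀ k, 1 ≤ k → s k = 0) (n k : ℕ) :
    catA s n k = (n.choose ((n + k + 1) / 2) : ℝ) := by
  induction n generalizing k with
  | zero =>
    rcases k with _ | k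
    · simp [catA]
    · rw [Nat.choose_eq_zero_of_lt (by lia)]
      simp [catA]
  | succ n ih =>
    rcases k with _ | k
    · have hk : (n + 1 + 0 + 1) / 2 = n / 2 + 1 := by lia
      have hk' : (n + (0 + 1) + 1) / 2 = n / 2 + 1 := by lia
      rw [hk, Nat.choose_succ_succ, ← choose_half_succ]
      simp only [catA, ih, hk', h0]
      push_cast
      simp
    · have hk : (n + 1 + (k + 1) + 1) / 2 = (n + k + 1) / 2 + 1 := by lia
      have hk' : (n + (k + 1 + 1) + 1) / 2 = (n + k + 1) / 2 + 1 := by lia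
      rw [hk, Nat.choose_succ_succ]
      simp [catA, ih, hk', h1]

/-- For the sequence `s = (1, 0, 0, …)` the Catalan-like numbers are the central
binomial coefficients: `aₙ(s) = C(n, ⌊n/2⌋)`. -/
theorem catA_central_binomial (s : ℕ → ℝ) (h0 : s 0 = 1) (h1 : ∀ k, 1 ≤ k → s k = 0)
    (n : ℕ) :
    catA s n 0 = (Nat.choose n (n / 2) : ℝ) := by
  rw [catA_eq_choose s h0 h1, Nat.add_zero, choose_half_succ]
end
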